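/- Let δ > 0 and let η be a positive random variable with probability density p, 𝔼(η) = 1 and 𝔼(η^{2+δ}) ≤ M_δ < ∞. Let L, T′, ε′ > 0 and let λ : ℝ → [0, L] be measurable with ∫_s^{s+T} λ(t) dt < T(1−ε′) for every s and every T ≥ T′. Fix y ∈ ℝ, and for t ≥ 0 let Λ(t) = ∫_{y−t}^{y} λ(u) du and define 𝒬(t) = Σ_{n=1}^∞ p^{∗n}(t) · ℙ( N(t) ≥ n−1 ), where N(t) is a Poisson random variable with parameter Λ(t) and p^{∗n} is the n-fold convolution of p. Then for every b with 0 ≤ b < δ/2 one has ∫_0^∞ t^b 𝒬(t) dt ≤ C, where C < ∞ depends only on b, δ, M_δ, L, T′ and ε′ (in particular it is uniform in y and depends on λ only through T′ and ε′). -/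

import Mathlib

open MeasureTheory

/-- Convolution on `ℝ` (with respect to Lebesgue measure). -/
noncomputable def conv (a b : ℝ → ℝ) : ℝ → ℝ := fun x => ∫ t, a (x - t) * b t

/-- `convPow p n` is the `(n+1)`-fold convolution power `p^{∗(n+1)}` of `p`:
`convPow p 0 = p` and `convPow p (n+1) = (convPow p n) ∗ p`. -/
noncomputable def convPow (p : ℝ → ℝ) : ℕ → ℝ → ℝ
  | 0 => p
  | n + 1 => conv (convPow p n) p

/-- The convex function `w ↦ w ^ s` lies above its tangent line at `w`, evaluated at `1`. -/
lemma rpow_le_one_add_mul_rpow_sub_one {s w : ℝ} (hs : 1 ≤ s) (hw : 0 < w) :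
    w ^ s ≤ 1 + s * (w - 1) * w ^ (s - 1) := by
  have hbern := one_add_mul_self_le_rpow_one_add (s := w⁻¹ - 1) (p := s)
    (by have := inv_pos.2 hw; linarith) hs
  rw [add_sub_cancel, Real.inv_rpow hw.le] at hbern
  have hpos : 0 < w ^ s := Real.rpow_pos_of_pos hw s
  have hmul := mul_le_mul_of_nonneg_right hbern hpos.le
  rw [inv_mul_cancel₀ hpos.ne'] at hmul
  have hsub : w ^ (s - 1) = w ^ s * w⁻¹ := by
    rw [Real.rpow_sub_one hw.ne', div_eq_mul_inv]
  have hww : w * w⁻¹ = 1 := mul_inv_cancel₀ hw.ne'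
  rw [hsub]
  linear_combination hmul - s * w ^ s * hww

lemma one_add_rpow_le_quadratic {d z : ℝ} (hd : 0 ≤ d) (hz : |z| ≤ 1 / 2) :
    (1 + z) ^ (2 + d) ≤ 1 + (2 + d) * z + (2 + d) * (1 + d) * 2 ^ d * z ^ 2 := by
  obtain ⟨hz1, hz2⟩ := abs_le.1 hz
  have hw : 0 < 1 + z := by linarith
  have h1 := rpow_le_one_add_mul_rpow_sub_one (s := 2 + d) (by linarith) hw
  have h2 := rpow_le_one_add_mul_rpow_sub_one (s := 1 + d) (by linarith) hw
  have h3 := one_add_mul_self_le_rpow_one_add (s := z) (p := 1 + d) (by linarith) (by linarith)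
  rw [show 2 + d - 1 = 1 + d by ring] at h1
  rw [show 1 + d - 1 = d by ring] at h2
  have h4 : (1 : ℝ) ≤ 2 ^ d := Real.one_le_rpow (by norm_num) hd
  have h5 : (1 + z) ^ d ≤ 2 ^ d := Real.rpow_le_rpow hw.le (by linarith) hd
  have key : z * ((1 + z) ^ (1 + d) - 1) ≤ (1 + d) * 2 ^ d * z ^ 2 := by
    rcases le_total 0 z with hz0 | hz0
    · calc z * ((1 + z) ^ (1 + d) - 1) ≤ z * ((1 + d) * z * (1 + z) ^ d) := by
            gcongr; linarith
        _ ≤ z * ((1 + d) * z * 2 ^ d) := by gcongr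
        _ = _ := by ring
    · calc z * ((1 + z) ^ (1 + d) - 1) ≤ z * ((1 + d) * z) :=
            mul_le_mul_of_nonpos_left (by linarith) hz0
        _ = (1 + d) * 1 * z ^ 2 := by ring
        _ ≤ _ := by gcongr
  nlinarith [mul_le_mul_of_nonneg_left key (by linarith : 0 ≤ 2 + d)]

/-- The constant in the second-order expansion of `x ↦ (max x 0) ^ (2 + d)`. -/
noncomputable def posPartConst (d : ℝ) : ℝ :=
  3 ^ (2 + d) + (2 + d) * 2 ^ (1 + d) + (2 + d) * (1 + d) * 2 ^ d

lemma posPartConst_nonneg {d : ℝ} (hd : 0 ≤ d) : 0 ≤ posPartConst d := by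
  unfold posPartConst; positivity

lemma posPart_rpow_add_le {d : ℝ} (hd : 0 ≤ d) (x y : ℝ) :
    (max (x + y) 0) ^ (2 + d) ≤ (max x 0) ^ (2 + d) + (2 + d) * (max x 0) ^ (1 + d) * y +
      posPartConst d * ((max x 0) ^ d * y ^ 2 + |y| ^ (2 + d)) := by
  have hc1 : (0 : ℝ) ≤ 3 ^ (2 + d) := by positivity
  have hc2 : (0 : ℝ) ≤ (2 + d) * 2 ^ (1 + d) := by positivity
  have hc3 : (0 : ℝ) ≤ (2 + d) * (1 + d) * 2 ^ d := by positivity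
  rcases le_or_gt x 0 with hx | hx
  · rw [max_eq_right hx, Real.zero_rpow (by linarith), Real.zero_rpow (by linarith)]
    have hmax : max (x + y) 0 ≤ |y| :=
      max_le (by linarith [le_abs_self y]) (abs_nonneg y)
    have h1 : (max (x + y) 0) ^ (2 + d) ≤ |y| ^ (2 + d) :=
      Real.rpow_le_rpow (le_max_right _ _) hmax (by linarith)
    have h2 : (1 : ℝ) ≤ posPartConst d := by
      have : (1 : ℝ) ≤ 3 ^ (2 + d) := Real.one_le_rpow (by norm_num) (by linarith)
      unfold posPartConst; linarith
    have h3 : (0 : ℝ) ≤ 0 ^ d * y ^ 2 := by positivity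
    have h4 : 0 ≤ |y| ^ (2 + d) := by positivity
    nlinarith
  rw [max_eq_left hx.le]
  have hA : 0 ≤ x ^ d * y ^ 2 := by positivity
  have hB : 0 ≤ |y| ^ (2 + d) := by positivity
  have hxr : 0 ≤ x ^ (2 + d) := by positivity
  rcases le_or_gt |y| (x / 2) with hy | hy
  · have hz : |y / x| ≤ 1 / 2 := by
      rw [abs_div, abs_of_pos hx, div_le_iff₀ hx]; linarith
    have hxy : 0 ≤ x + y := by linarith [neg_abs_le y]
    have hq := mul_le_mul_of_nonneg_left (one_add_rpow_le_quadratic hd hz) hxr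
    have hz1 : 0 ≤ 1 + y / x := by linarith [(abs_le.1 hz).1]
    rw [← Real.mul_rpow hx.le hz1, show x * (1 + y / x) = x + y by field_simp] at hq
    rw [max_eq_left hxy]
    have e1 : x ^ (2 + d) = x ^ d * x ^ 2 := by
      rw [add_comm, Real.rpow_add hx, Real.rpow_two]
    have e2 : x ^ (1 + d) = x ^ d * x := by
      rw [add_comm, Real.rpow_add hx, Real.rpow_one]
    have e3 : x ^ d * x ^ 2 * (1 + (2 + d) * (y / x) + (2 + d) * (1 + d) * 2 ^ d * (y / x) ^ 2)
        = x ^ d * x ^ 2 + (2 + d) * (x ^ d * x) * y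
          + (2 + d) * (1 + d) * 2 ^ d * (x ^ d * y ^ 2) := by
      field_simp
    rw [e1, e3] at hq
    rw [e1, e2]
    unfold posPartConst
    nlinarith [mul_nonneg hc1 hA, mul_nonneg hc2 hA, mul_nonneg hc1 hB, mul_nonneg hc2 hB,
      mul_nonneg hc3 hB]
  · have hy0 : 0 < |y| := by linarith
    have h1 : (max (x + y) 0) ^ (2 + d) ≤ 3 ^ (2 + d) * |y| ^ (2 + d) := by
      rw [← Real.mul_rpow (by norm_num) hy0.le]
      refine Real.rpow_le_rpow (le_max_right _ _) (max_le ?_ (by positivity)) (by linarith)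
      linarith [le_abs_self y]
    have h2 : x ^ (1 + d) * |y| ≤ 2 ^ (1 + d) * |y| ^ (2 + d) := by
      calc x ^ (1 + d) * |y| ≤ (2 * |y|) ^ (1 + d) * |y| := by gcongr; linarith
        _ = 2 ^ (1 + d) * |y| ^ (2 + d) := by
          rw [Real.mul_rpow (by norm_num) hy0.le, show 2 + d = (1 + d) + 1 by ring,
            Real.rpow_add_one hy0.ne']; ring
    have h3 : -(x ^ (1 + d) * |y|) ≤ x ^ (1 + d) * y := by
      have : 0 ≤ x ^ (1 + d) := by positivity
      nlinarith [neg_abs_le y]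
    have h4 : (2 + d) * (-(2 ^ (1 + d) * |y| ^ (2 + d))) ≤ (2 + d) * (x ^ (1 + d) * y) := by
      gcongr; linarith
    unfold posPartConst
    nlinarith [mul_nonneg hc1 hA, mul_nonneg hc2 hA, mul_nonneg hc3 hA, mul_nonneg hc3 hB]

lemma mul_rpow_le_rpow_add_two_div {d C N x : ℝ} (hd : 0 ≤ d) (hC : 0 ≤ C) (hN : 0 < N)
    (hx : 0 ≤ x) :
    C * x ^ d ≤ x ^ (2 + d) / (2 * N) + C * (2 * C) ^ (d / 2) * N ^ (d / 2) := by
  rcases le_or_gt (2 * C * N) (x ^ 2) with h | h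
  · have h1 : x ^ (2 + d) = x ^ 2 * x ^ d := by
      rw [Real.rpow_add_of_nonneg hx (by norm_num) hd, Real.rpow_two]
    have h2 : C * x ^ d ≤ x ^ (2 + d) / (2 * N) := by
      rw [le_div_iff₀ (by positivity), h1]
      nlinarith [mul_le_mul_of_nonneg_right h (Real.rpow_nonneg hx d)]
    have : 0 ≤ C * (2 * C) ^ (d / 2) * N ^ (d / 2) := by positivity
    linarith
  · have h1 : x ^ d ≤ (2 * C) ^ (d / 2) * N ^ (d / 2) := by
      rw [← Real.mul_rpow (by positivity) hN.le]
      calc x ^ d = (x ^ 2) ^ (d / 2) := by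
            rw [← Real.rpow_two, ← Real.rpow_mul hx]; congr 1; ring
        _ ≤ _ := Real.rpow_le_rpow (by positivity) h.le (by positivity)
    have h2 : 0 ≤ x ^ (2 + d) / (2 * N) := by positivity
    nlinarith [mul_le_mul_of_nonneg_left h1 hC]

/-- Chernoff bound for the upper tail of a Poisson variable. -/
lemma poisson_tail_le {a θ : ℝ} (ha : 0 ≤ a) (hθ : 1 ≤ θ) (n : ℕ) :
    Real.exp (-a) * ∑' k : ℕ, a ^ (n + k) / (Nat.factorial (n + k) : ℝ) ≤
      (θ⁻¹) ^ n * Real.exp ((θ - 1) * a) := by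
  have hθ0 : 0 < θ := by linarith
  have hs := Real.summable_pow_div_factorial (θ * a)
  have hinj : Function.Injective (fun k : ℕ => n + k) := add_right_injective n
  have hterm : ∀ k : ℕ, a ^ (n + k) / (Nat.factorial (n + k) : ℝ) ≤
      (θ⁻¹) ^ n * ((θ * a) ^ (n + k) / (Nat.factorial (n + k) : ℝ)) := by
    intro k
    rw [← mul_div_assoc]
    gcongr
    rw [mul_pow, pow_add θ, inv_pow]
    have : 1 ≤ θ ^ k := one_le_pow₀ hθ
    have hn : θ ^ n ≠ 0 := by positivity
    rw [show (θ ^ n)⁻¹ * (θ ^ n * θ ^ k * a ^ (n + k)) = θ ^ k * a ^ (n + k) by field_simp]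
    exact le_mul_of_one_le_left (by positivity) this
  have h1 : ∑' k : ℕ, a ^ (n + k) / (Nat.factorial (n + k) : ℝ) ≤
      (θ⁻¹) ^ n * ∑' k : ℕ, (θ * a) ^ (n + k) / (Nat.factorial (n + k) : ℝ) := by
    rw [← tsum_mul_left]
    exact Summable.tsum_le_tsum hterm
      ((Real.summable_pow_div_factorial a).comp_injective hinj)
      ((hs.comp_injective hinj).mul_left _)
  have h2 : ∑' k : ℕ, (θ * a) ^ (n + k) / (Nat.factorial (n + k) : ℝ) ≤ Real.exp (θ * a) := by
    rw [Real.exp_eq_exp_ℝ, NormedSpace.exp_eq_tsum_div]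
    exact tsum_comp_le_tsum_of_inj hs (fun k => by positivity) hinj
  calc _ ≤ Real.exp (-a) * ((θ⁻¹) ^ n * Real.exp (θ * a)) := by gcongr; exact h1.trans (by gcongr)
    _ = (θ⁻¹) ^ n * Real.exp ((θ - 1) * a) := by
      rw [show (θ - 1) * a = -a + θ * a by ring, Real.exp_add]; ring

lemma exp_neg_mul_le_rpow_neg {a ρ x : ℝ} (ha : 0 < a) (hρ : 0 < ρ) (hx : 0 < x) :
    Real.exp (-(ρ * x)) ≤ (a / ρ) ^ a * x ^ (-a) := by
  have h1 : ρ * x / a ≤ Real.exp (ρ * x / a) := by linarith [Real.add_one_le_exp (ρ * x / a)]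
  have h2 := Real.rpow_le_rpow (by positivity) h1 ha.le
  rw [← Real.exp_mul, div_mul_cancel₀ _ ha.ne'] at h2
  have h3 : (a / ρ) ^ a * x ^ (-a) = ((ρ * x / a) ^ a)⁻¹ := by
    rw [Real.rpow_neg hx.le, ← Real.inv_rpow hx.le, ← Real.mul_rpow (by positivity) (by positivity),
      ← Real.inv_rpow (by positivity)]
    congr 1
    field_simp
  rw [h3, Real.exp_neg]
  gcongr

lemma measurable_convPow {p : ℝ → ℝ} (hp : Measurable p) (n : ℕ) : Measurable (convPow p n) := by
  induction n with
  | zero => exact hp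
  | succ n ih =>
    have h : StronglyMeasurable (Function.uncurry fun x t : ℝ => convPow p n (x - t) * p t) :=
      ((ih.comp (measurable_fst.sub measurable_snd)).mul
        (hp.comp measurable_snd)).stronglyMeasurable
    exact h.integral_prod_right.measurable

lemma convPow_nonneg {p : ℝ → ℝ} (hp : ∀ t, 0 ≤ p t) (n : ℕ) (t : ℝ) : 0 ≤ convPow p n t := by
  induction n generalizing t with
  | zero => exact hp t
  | succ n ih => exact integral_nonneg fun s => mul_nonneg (ih _) (hp s)

lemma lintegral_mul_convPow_succ_le {p : ℝ → ℝ} (hpm : Measurable p) (hp : ∀ t, 0 ≤ p t) (n : ℕ)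
    {f : ℝ → ENNReal} (hf : Measurable f) :
    ∫⁻ x, f x * ENNReal.ofReal (convPow p (n + 1) x) ≤
      ∫⁻ x, (∫⁻ t, f (x + t) * ENNReal.ofReal (p t)) * ENNReal.ofReal (convPow p n x) := by
  have hA := (measurable_convPow hpm n).ennreal_ofReal
  have hP := hpm.ennreal_ofReal
  have hpt : ∀ x, ENNReal.ofReal (convPow p (n + 1) x) ≤
      ∫⁻ t, ENNReal.ofReal (convPow p n (x - t)) * ENNReal.ofReal (p t) := by
    intro x
    have h0 : ∀ t, 0 ≤ convPow p n (x - t) * p t :=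
      fun t => mul_nonneg (convPow_nonneg hp n _) (hp t)
    calc ENNReal.ofReal (convPow p (n + 1) x)
        = ‖∫ t, convPow p n (x - t) * p t‖ₑ :=
          (Real.enorm_of_nonneg (integral_nonneg h0)).symm
      _ ≤ ∫⁻ t, ‖convPow p n (x - t) * p t‖ₑ := enorm_integral_le_lintegral_enorm _
      _ = _ := by
          refine lintegral_congr fun t => ?_
          rw [Real.enorm_of_nonneg (h0 t), ENNReal.ofReal_mul (convPow_nonneg hp n _)]
  generalize hgA : (fun x => ENNReal.ofReal (convPow p n x)) = A at hA
  generalize hgP : (fun x => ENNReal.ofReal (p x)) = P at hP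
  simp only [congrFun hgA _, congrFun hgP _] at hpt ⊢
  calc ∫⁻ x, f x * ENNReal.ofReal (convPow p (n + 1) x)
      ≤ ∫⁻ x, ∫⁻ t, f x * (A (x - t) * P t) := by
        refine lintegral_mono fun x => ?_
        rw [lintegral_const_mul _ (by fun_prop)]
        exact mul_le_mul_right (hpt x) _
    _ = ∫⁻ t, ∫⁻ x, f x * (A (x - t) * P t) :=
        lintegral_lintegral_swap ((hf.comp measurable_fst).mul
          ((hA.comp (measurable_fst.sub measurable_snd)).mul (hP.comp measurable_snd))).aemeasurable
    _ = ∫⁻ t, ∫⁻ x, f (x + t) * (A x * P t) := by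
        refine lintegral_congr fun t => ?_
        rw [← lintegral_add_right_eq_self _ t]
        simp only [add_sub_cancel_right]
    _ = ∫⁻ x, ∫⁻ t, f (x + t) * (A x * P t) :=
        lintegral_lintegral_swap ((hf.comp (measurable_snd.add measurable_fst)).mul
          ((hA.comp measurable_snd).mul (hP.comp measurable_fst))).aemeasurable
    _ = _ := by
        refine lintegral_congr fun x => ?_
        rw [← lintegral_mul_const _ (by fun_prop)]
        exact lintegral_congr fun t => by ring

lemma lintegral_ofReal_eq_one {p : ℝ → ℝ} (hp : ∀ t, 0 ≤ p t) (hp0 : ∀ t ≤ (0 : ℝ), p t = 0)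
    (h1 : (∫ t in Set.Ioi (0 : ℝ), p t) = 1) : ∫⁻ t, ENNReal.ofReal (p t) = 1 := by
  have hint : Integrable p (volume.restrict (Set.Ioi 0)) :=
    Integrable.of_integral_ne_zero (by rw [h1]; norm_num)
  have h := ofReal_integral_eq_lintegral_ofReal hint (Filter.Eventually.of_forall hp)
  rw [h1, ENNReal.ofReal_one] at h
  rw [h, ← lintegral_indicator measurableSet_Ioi]
  refine lintegral_congr fun t => ?_
  by_cases ht : 0 < t
  · simp [ht]
  · simp [ht, hp0 t (not_lt.1 ht)]

lemma lintegral_convPow_le_one {p : ℝ → ℝ} (hpm : Measurable p) (hp : ∀ t, 0 ≤ p t)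
    (hp1 : ∫⁻ t, ENNReal.ofReal (p t) = 1) (n : ℕ) :
    ∫⁻ t, ENNReal.ofReal (convPow p n t) ≤ 1 := by
  induction n with
  | zero => exact hp1.le
  | succ n ih =>
    have h := lintegral_mul_convPow_succ_le hpm hp n (f := fun _ => 1) measurable_const
    simp only [one_mul, hp1] at h
    exact h.trans ih

lemma lintegral_posPart_rpow_add_le {d M : ℝ} (hd : 0 ≤ d) {p : ℝ → ℝ}
    (hp : ∀ t, 0 ≤ p t) (hp0 : ∀ t ≤ (0 : ℝ), p t = 0)
    (h1 : (∫ t in Set.Ioi (0 : ℝ), p t) = 1) (hmean : (∫ t in Set.Ioi (0 : ℝ), t * p t) = 1)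
    (hint : IntegrableOn (fun t => t ^ (2 + d) * p t) (Set.Ioi 0))
    (hM : (∫ t in Set.Ioi (0 : ℝ), t ^ (2 + d) * p t) ≤ M) (x : ℝ) :
    ∫⁻ t, ENNReal.ofReal ((max (x + t - 1) 0) ^ (2 + d)) * ENNReal.ofReal (p t) ≤
      ENNReal.ofReal ((max x 0) ^ (2 + d) +
        posPartConst d * (M + 2) * ((max x 0) ^ d + 1)) := by
  set X := max x 0 with hX
  have hX0 : 0 ≤ X := le_max_right _ _
  have hc := posPartConst_nonneg hd
  set c := posPartConst d
  set F : ℝ → ℝ := fun t => X ^ (2 + d) + (2 + d) * X ^ (1 + d) * (t - 1) +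
      c * (X ^ d + 1) * (t ^ (2 + d) + 2) with hF
  have hpi : Integrable p (volume.restrict (Set.Ioi 0)) :=
    Integrable.of_integral_ne_zero (by rw [h1]; norm_num)
  have hti : Integrable (fun t => t * p t) (volume.restrict (Set.Ioi 0)) :=
    Integrable.of_integral_ne_zero (by rw [hmean]; norm_num)
  have hpt : ∀ t, 0 < t → (max (x + t - 1) 0) ^ (2 + d) ≤ F t := by
    intro t ht
    have hmain := posPart_rpow_add_le hd x (t - 1)
    rw [show x + (t - 1) = x + t - 1 by ring, ← hX] at hmain
    have htr : 0 ≤ t ^ (2 + d) := by positivity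
    have hle : |t - 1| ^ (2 + d) ≤ t ^ (2 + d) + 1 := by
      rcases le_total t 1 with h | h
      · have : |t - 1| ^ (2 + d) ≤ 1 :=
          Real.rpow_le_one (abs_nonneg _) (abs_le.2 ⟨by linarith, by linarith⟩) (by linarith)
        linarith
      · have : |t - 1| ^ (2 + d) ≤ t ^ (2 + d) :=
          Real.rpow_le_rpow (abs_nonneg _) (abs_le.2 ⟨by linarith, by linarith⟩) (by linarith)
        linarith
    have hsq : (t - 1) ^ 2 ≤ t ^ (2 + d) + 2 := by
      rcases le_total t 1 with h | h
      · nlinarith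
      · have : t ^ (2 : ℝ) ≤ t ^ (2 + d) := Real.rpow_le_rpow_of_exponent_le h (by linarith)
        rw [Real.rpow_two] at this
        nlinarith
    have hXd : 0 ≤ X ^ d := by positivity
    have hsum : X ^ d * (t - 1) ^ 2 + |t - 1| ^ (2 + d) ≤ (X ^ d + 1) * (t ^ (2 + d) + 2) := by
      nlinarith [mul_le_mul_of_nonneg_left hsq hXd]
    have := mul_le_mul_of_nonneg_left hsum hc
    simp only [hF]
    linarith
  have hFp : (fun t => F t * p t) = fun t =>
      (X ^ (2 + d) - (2 + d) * X ^ (1 + d) + 2 * (c * (X ^ d + 1))) * p t +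
        (2 + d) * X ^ (1 + d) * (t * p t) + c * (X ^ d + 1) * (t ^ (2 + d) * p t) := by
    funext t; simp only [hF]; ring
  have hi1 := hpi.const_mul (X ^ (2 + d) - (2 + d) * X ^ (1 + d) + 2 * (c * (X ^ d + 1)))
  have hi2 := hti.const_mul ((2 + d) * X ^ (1 + d))
  have hi3 := Integrable.const_mul hint (c * (X ^ d + 1))
  have hFi : Integrable (fun t => F t * p t) (volume.restrict (Set.Ioi 0)) := by
    rw [hFp]; exact (hi1.add hi2).add hi3
  have hFv : ∫ t in Set.Ioi (0 : ℝ), F t * p t =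
      X ^ (2 + d) + c * (X ^ d + 1) * ((∫ t in Set.Ioi (0 : ℝ), t ^ (2 + d) * p t) + 2) := by
    have hi12 : Integrable (fun t : ℝ =>
        (X ^ (2 + d) - (2 + d) * X ^ (1 + d) + 2 * (c * (X ^ d + 1))) * p t +
          (2 + d) * X ^ (1 + d) * (t * p t)) (volume.restrict (Set.Ioi 0)) := hi1.add hi2
    rw [hFp, integral_add hi12 hi3, integral_add hi1 hi2, integral_const_mul,
      integral_const_mul, integral_const_mul, h1, hmean]
    ring
  have hF0 : 0 ≤ᵐ[volume.restrict (Set.Ioi 0)] fun t => F t * p t := by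
    filter_upwards [ae_restrict_mem measurableSet_Ioi] with t ht
    exact mul_nonneg (le_trans (Real.rpow_nonneg (le_max_right _ _) _) (hpt t ht)) (hp t)
  calc ∫⁻ t, ENNReal.ofReal ((max (x + t - 1) 0) ^ (2 + d)) * ENNReal.ofReal (p t)
      ≤ ∫⁻ t, (Set.Ioi 0).indicator (fun t => ENNReal.ofReal (F t * p t)) t := by
        refine lintegral_mono fun t => ?_
        by_cases ht : 0 < t
        · rw [Set.indicator_of_mem (Set.mem_Ioi.2 ht), ← ENNReal.ofReal_mul' (hp t)]
          exact ENNReal.ofReal_le_ofReal (mul_le_mul_of_nonneg_right (hpt t ht) (hp t))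
        · simp [hp0 t (not_lt.1 ht)]
    _ = ENNReal.ofReal (∫ t in Set.Ioi (0 : ℝ), F t * p t) := by
        rw [lintegral_indicator measurableSet_Ioi, ofReal_integral_eq_lintegral_ofReal hFi hF0]
    _ ≤ _ := by
        rw [hFv]
        refine ENNReal.ofReal_le_ofReal ?_
        have : 0 ≤ c * (X ^ d + 1) := by positivity
        nlinarith [mul_le_mul_of_nonneg_left hM this]

/-- With `B` bounding the one-step error, the constant in the moment bound for the positive part
of the centred random walk. -/
noncomputable def momentConst (d B : ℝ) : ℝ :=
  2 * (B * (2 * B) ^ (d / 2) + B)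

lemma lintegral_posPart_convPow_le {d M : ℝ} (hd : 0 ≤ d) (hM0 : 0 ≤ M) {p : ℝ → ℝ}
    (hpm : Measurable p) (hp : ∀ t, 0 ≤ p t) (hp0 : ∀ t ≤ (0 : ℝ), p t = 0)
    (h1 : (∫ t in Set.Ioi (0 : ℝ), p t) = 1) (hmean : (∫ t in Set.Ioi (0 : ℝ), t * p t) = 1)
    (hint : IntegrableOn (fun t => t ^ (2 + d) * p t) (Set.Ioi 0))
    (hM : (∫ t in Set.Ioi (0 : ℝ), t ^ (2 + d) * p t) ≤ M) (n : ℕ) :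
    ∫⁻ t : ℝ, ENNReal.ofReal ((max (t - (n + 1)) 0) ^ (2 + d)) * ENNReal.ofReal (convPow p n t) ≤
      ENNReal.ofReal (momentConst d (posPartConst d * (M + 2)) * ((n : ℝ) + 1) ^ (1 + d / 2)) := by
  have step := lintegral_posPart_rpow_add_le hd hp hp0 h1 hmean hint hM
  have hB : 0 ≤ posPartConst d * (M + 2) := mul_nonneg (posPartConst_nonneg hd) (by linarith)
  set B := posPartConst d * (M + 2)
  set D := B * (2 * B) ^ (d / 2) with hD
  have hD0 : 0 ≤ D := by positivity
  have hA : momentConst d B = 2 * (D + B) := rfl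
  induction n with
  | zero =>
    refine (step 0 |>.trans' (le_of_eq ?_)).trans (ENNReal.ofReal_le_ofReal ?_)
    · simp [convPow]
    · have h0d : (0 : ℝ) ^ d ≤ 1 := Real.rpow_le_one le_rfl zero_le_one hd
      have := mul_le_mul_of_nonneg_left h0d hB
      rw [max_self, Real.zero_rpow (by linarith), hA]
      simp only [Nat.cast_zero, zero_add, Real.one_rpow]
      linarith
  | succ n ih =>
    set N : ℝ := (n : ℝ) + 1 with hN
    have hNpos : 0 < N := by positivity
    have hN1 : 1 ≤ N := by rw [hN]; linarith [n.cast_nonneg (α := ℝ)]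
    have hVm : Measurable fun t : ℝ => ENNReal.ofReal ((max (t - N) 0) ^ (2 + d)) := by fun_prop
    have hAm := (measurable_convPow hpm n).ennreal_ofReal
    have hVAm : Measurable fun t : ℝ => ENNReal.ofReal ((max (t - N) 0) ^ (2 + d)) *
        ENNReal.ofReal (convPow p n t) := hVm.mul hAm
    have hNd : 1 ≤ N ^ (d / 2) := Real.one_le_rpow hN1 (by positivity)
    have hpt : ∀ x : ℝ,
        ∫⁻ t, ENNReal.ofReal ((max (x + t - (((n + 1 : ℕ) : ℝ) + 1)) 0) ^ (2 + d)) *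
          ENNReal.ofReal (p t) ≤
        ENNReal.ofReal (1 + 1 / (2 * N)) * ENNReal.ofReal ((max (x - N) 0) ^ (2 + d)) +
          ENNReal.ofReal ((D + B) * N ^ (d / 2)) := by
      intro x
      have hx0 : 0 ≤ max (x - N) 0 := le_max_right _ _
      have hx := step (x - N)
      have hyoung := mul_rpow_le_rpow_add_two_div hd hB hNpos hx0
      rw [← ENNReal.ofReal_mul (by positivity), ← ENNReal.ofReal_add (by positivity) (by positivity)]
      refine (hx.trans' (le_of_eq ?_)).trans (ENNReal.ofReal_le_ofReal ?_)
      · refine lintegral_congr fun t => ?_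
        push_cast
        rw [show x + t - ((n : ℝ) + 1 + 1) = x - N + t - 1 by rw [hN]; ring]
      · have hBN := mul_le_mul_of_nonneg_left hNd hB
        rw [← hD] at hyoung
        have : (1 + 1 / (2 * N)) * (max (x - N) 0) ^ (2 + d) =
            (max (x - N) 0) ^ (2 + d) + (max (x - N) 0) ^ (2 + d) / (2 * N) := by ring
        rw [this]
        linarith
    calc _ ≤ ∫⁻ x, (∫⁻ t, ENNReal.ofReal ((max (x + t - (((n + 1 : ℕ) : ℝ) + 1)) 0) ^ (2 + d)) *
          ENNReal.ofReal (p t)) * ENNReal.ofReal (convPow p n x) :=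
          lintegral_mul_convPow_succ_le hpm hp n (by fun_prop)
      _ ≤ ∫⁻ x, (ENNReal.ofReal (1 + 1 / (2 * N)) *
            (ENNReal.ofReal ((max (x - N) 0) ^ (2 + d)) * ENNReal.ofReal (convPow p n x)) +
          ENNReal.ofReal ((D + B) * N ^ (d / 2)) * ENNReal.ofReal (convPow p n x)) := by
          refine lintegral_mono fun x => ?_
          rw [← mul_assoc, ← add_mul]
          exact mul_le_mul_left (hpt x) _
      _ = ENNReal.ofReal (1 + 1 / (2 * N)) *
            (∫⁻ x, ENNReal.ofReal ((max (x - N) 0) ^ (2 + d)) * ENNReal.ofReal (convPow p n x)) +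
          ENNReal.ofReal ((D + B) * N ^ (d / 2)) * ∫⁻ x, ENNReal.ofReal (convPow p n x) := by
          rw [lintegral_add_left (hVAm.const_mul _), lintegral_const_mul _ hVAm,
            lintegral_const_mul _ hAm]
      _ ≤ ENNReal.ofReal (1 + 1 / (2 * N)) *
            ENNReal.ofReal (momentConst d B * N ^ (1 + d / 2)) +
          ENNReal.ofReal ((D + B) * N ^ (d / 2)) * 1 := by
          gcongr
          exact lintegral_convPow_le_one hpm hp (lintegral_ofReal_eq_one hp hp0 h1) n
      _ ≤ _ := by
          rw [mul_one, ← ENNReal.ofReal_mul (by positivity), hA,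
            ← ENNReal.ofReal_add (by positivity) (by positivity)]
          refine ENNReal.ofReal_le_ofReal ?_
          have hbern := one_add_mul_self_le_rpow_one_add (s := 1 / N) (p := 1 + d / 2)
            (by have : 0 < 1 / N := by positivity
                linarith) (by linarith)
          have hpow : N ^ (1 + d / 2) = N * N ^ (d / 2) := by
            rw [Real.rpow_add hNpos, Real.rpow_one]
          have hN' : (((n + 1 : ℕ) : ℝ) + 1) = N * (1 + 1 / N) := by
            push_cast; rw [hN]; field_simp
          rw [hN', Real.mul_rpow hNpos.le (by positivity)]
          have hle : N ^ (1 + d / 2) * (1 + 1 / N) ≤ N ^ (1 + d / 2) * (1 + 1 / N) ^ (1 + d / 2) := by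
            gcongr
            have : 0 ≤ d / 2 * (1 / N) := by positivity
            linarith
          have := mul_le_mul_of_nonneg_left hle (by positivity : 0 ≤ 2 * (D + B))
          refine le_trans (le_of_eq ?_) this
          rw [hpow]
          field_simp
          ring

/-- A Poisson tail of parameter at most `(1 - ε) t + c₀`, weighted by `t ^ b`: if
`t ≤ (1 + ε) (n + 1)` the tail is exponentially small, otherwise `t` exceeds `n + 1` by a
proportional amount. -/
lemma exists_rpow_mul_poisson_tail_le {ε b d c₀ : ℝ} (hε : 0 < ε) (hε1 : ε < 1) (hb : 0 ≤ b)
    (hd : 0 ≤ d) (hbd : b ≤ 2 + d) :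
    ∃ K₁ K₂ : ℝ, 0 ≤ K₁ ∧ 0 ≤ K₂ ∧ ∀ (n : ℕ) (t a : ℝ), 0 < t → 0 ≤ a →
      a ≤ (1 - ε) * t + c₀ →
      t ^ b * (Real.exp (-a) * ∑' k : ℕ, a ^ (n + k) / (Nat.factorial (n + k) : ℝ)) ≤
        K₁ * ((n : ℝ) + 1) ^ (b - (1 + d / 2)) +
          K₂ * ((n : ℝ) + 1) ^ (b - (2 + d)) * (max (t - (n + 1)) 0) ^ (2 + d) := by
  set q := ε ^ 2 with hq
  have hq0 : 0 < q := by positivity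
  have hq1 : q < 1 := by nlinarith
  set θ := (1 - q / 2)⁻¹ with hθ
  have hθ1 : 1 ≤ θ := (one_le_inv₀ (by linarith)).2 (by linarith)
  have hθm : θ * (1 - q / 2) = 1 := inv_mul_cancel₀ (by linarith)
  set ρ := q / 2 - (θ - 1) * (1 - q) with hρ
  have hρ0 : 0 < ρ := by
    have : ρ = θ * (q ^ 2 / 4) := by
      rw [hρ]; linear_combination (q / 2 - 1) * hθm
    rw [this]; positivity
  refine ⟨2 ^ b * (Real.exp (q / 2 + (θ - 1) * c₀) * ((1 + d / 2) / ρ) ^ (1 + d / 2)),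
    (1 + 1 / ε) ^ b * ε ^ (b - (2 + d)), by positivity, by positivity, ?_⟩
  intro n t a ht ha hat
  set N : ℝ := (n : ℝ) + 1 with hN
  have hNpos : 0 < N := by positivity
  have htail0 : 0 ≤ Real.exp (-a) * ∑' k : ℕ, a ^ (n + k) / (Nat.factorial (n + k) : ℝ) :=
    mul_nonneg (Real.exp_pos _).le (tsum_nonneg fun k => by positivity)
  set w := Real.exp (-a) * ∑' k : ℕ, a ^ (n + k) / (Nat.factorial (n + k) : ℝ)
  rcases le_or_gt t ((1 + ε) * N) with h | h
  · have haN : a ≤ (1 - q) * N + c₀ := by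
      have := mul_le_mul_of_nonneg_left h (by linarith : 0 ≤ 1 - ε)
      rw [hq]; nlinarith
    have hw : w ≤ Real.exp (q / 2 + (θ - 1) * c₀) * Real.exp (-(ρ * N)) := by
      refine (poisson_tail_le ha hθ1 n).trans ?_
      have h1 : θ⁻¹ ≤ Real.exp (-(q / 2)) := by
        rw [hθ, inv_inv]; linarith [Real.add_one_le_exp (-(q / 2))]
      have h2 : (θ - 1) * a ≤ (θ - 1) * ((1 - q) * N + c₀) :=
        mul_le_mul_of_nonneg_left haN (by linarith)
      calc θ⁻¹ ^ n * Real.exp ((θ - 1) * a)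
          ≤ Real.exp (-(q / 2)) ^ n * Real.exp ((θ - 1) * ((1 - q) * N + c₀)) := by
            gcongr
        _ = _ := by
            rw [← Real.exp_nat_mul, ← Real.exp_add, ← Real.exp_add]
            congr 1
            rw [hρ, hN]; ring
    have hexp := exp_neg_mul_le_rpow_neg (a := 1 + d / 2) (by linarith) hρ0 hNpos
    have htb : t ^ b ≤ 2 ^ b * N ^ b := by
      rw [← Real.mul_rpow (by norm_num) hNpos.le]
      exact Real.rpow_le_rpow ht.le (by nlinarith) hb
    have hV : 0 ≤ (1 + 1 / ε) ^ b * ε ^ (b - (2 + d)) * N ^ (b - (2 + d)) *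
        (max (t - N) 0) ^ (2 + d) := by positivity
    have : t ^ b * w ≤ 2 ^ b * N ^ b * (Real.exp (q / 2 + (θ - 1) * c₀) *
        (((1 + d / 2) / ρ) ^ (1 + d / 2) * N ^ (-(1 + d / 2)))) := by
      refine mul_le_mul htb (hw.trans ?_) htail0 (by positivity)
      gcongr
    refine this.trans ((le_of_eq ?_).trans (le_add_of_nonneg_right hV))
    rw [sub_eq_add_neg b, Real.rpow_add hNpos]
    ring
  · have hx : ε * N < t - N := by linarith
    have hx0 : 0 < t - N := by have := mul_pos hε hNpos; linarith
    have hw : w ≤ 1 := by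
      have := poisson_tail_le ha le_rfl n
      simpa using this
    have htx : t ≤ (1 + 1 / ε) * (t - N) := by
      have : N ≤ (t - N) / ε := by rw [le_div_iff₀ hε]; linarith
      have e : (1 + 1 / ε) * (t - N) = (t - N) + (t - N) / ε := by ring
      rw [e]; linarith
    have htb : t ^ b ≤ (1 + 1 / ε) ^ b * (t - N) ^ b := by
      rw [← Real.mul_rpow (by positivity) hx0.le]
      exact Real.rpow_le_rpow ht.le htx hb
    have hxb : (t - N) ^ b ≤ ε ^ (b - (2 + d)) * N ^ (b - (2 + d)) * (t - N) ^ (2 + d) := by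
      rw [← Real.mul_rpow hε.le hNpos.le]
      calc (t - N) ^ b = (t - N) ^ (b - (2 + d)) * (t - N) ^ (2 + d) := by
            rw [← Real.rpow_add hx0]; congr 1; ring
        _ ≤ _ := by
            refine mul_le_mul_of_nonneg_right ?_ (by positivity)
            exact Real.rpow_le_rpow_of_nonpos (mul_pos hε hNpos) hx.le (by linarith)
    rw [max_eq_left hx0.le]
    calc t ^ b * w ≤ t ^ b * 1 := by gcongr
      _ ≤ (1 + 1 / ε) ^ b * (ε ^ (b - (2 + d)) * N ^ (b - (2 + d)) * (t - N) ^ (2 + d)) := by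
          rw [mul_one]; exact htb.trans (by gcongr)
      _ = (1 + 1 / ε) ^ b * ε ^ (b - (2 + d)) * N ^ (b - (2 + d)) * (t - N) ^ (2 + d) := by ring
      _ ≤ _ := le_add_of_nonneg_left (by positivity)

lemma intervalIntegral_le_of_average_lt {lam : ℝ → ℝ} {L T' ε : ℝ} (hL : 0 ≤ L) (hT' : 0 ≤ T')
    (hε1 : ε < 1) (hlam : ∀ t, 0 ≤ lam t ∧ lam t ≤ L)
    (havg : ∀ s T : ℝ, T' ≤ T → (∫ t in s..(s + T), lam t) < T * (1 - ε))
    (y : ℝ) {t : ℝ} (ht : 0 < t) :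
    (∫ u in (y - t)..y, lam u) ≤ (1 - ε) * t + L * T' := by
  rcases le_or_gt T' t with h | h
  · have := havg (y - t) t h
    rw [sub_add_cancel] at this
    have : 0 ≤ L * T' := by positivity
    linarith
  · have hbound := intervalIntegral.norm_integral_le_of_norm_le_const (a := y - t) (b := y)
      (f := lam) (C := L) fun x _ => by
        rw [Real.norm_of_nonneg (hlam x).1]; exact (hlam x).2
    rw [sub_sub_cancel, abs_of_pos ht] at hbound
    have h1 := (Real.le_norm_self _).trans hbound
    have h2 : L * t ≤ L * T' := by gcongr
    have h3 : 0 ≤ (1 - ε) * t := mul_nonneg (by linarith) ht.le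
    linarith

/-- **Lemma (moments of the kernel majorant).** Let `δ > 0` and let `η` be a positive
random variable with density `p`, mean `1` and `(2+δ)`-th moment at most `M_δ`. Let
`L, T', ε' > 0` and let `λ : ℝ → [0,L]` satisfy `∫_s^{s+T} λ < T(1−ε')` for all `s` and
all `T ≥ T'`. For `y ∈ ℝ` put `Λ(t) = ∫_{y−t}^y λ` and
`𝒬(t) = Σ_{n=1}^∞ p^{∗n}(t) · ℙ(N(t) ≥ n−1)` where `N(t)` is Poisson of parameter `Λ(t)`
(so `ℙ(N(t) ≥ m) = e^{−Λ(t)} Σ_{k ≥ m} Λ(t)^k / k!`). Then for every `0 ≤ b < δ/2`,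
`∫_0^∞ t^b 𝒬(t) dt ≤ C` for a constant `C` depending only on `b, δ, M_δ, L, T', ε'`
(in particular uniform in `y`, and depending on `λ` only through `T'` and `ε'`). -/
theorem kernel_majorant_moment_bound
    (δ Mδ L T' ε' b : ℝ) (hδ : 0 < δ) (hL : 0 < L) (hT' : 0 < T') (hε' : 0 < ε')
    (hb0 : 0 ≤ b) (hb : b < δ / 2) :
    ∃ C : ℝ, ∀ p : ℝ → ℝ, Measurable p → (∀ t, 0 ≤ p t) → (∀ t ≤ (0:ℝ), p t = 0) →
      (∫ t in Set.Ioi (0:ℝ), p t) = 1 →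
      (∫ t in Set.Ioi (0:ℝ), t * p t) = 1 →
      IntegrableOn (fun t => t ^ ((2:ℝ) + δ) * p t) (Set.Ioi 0) →
      (∫ t in Set.Ioi (0:ℝ), t ^ ((2:ℝ) + δ) * p t) ≤ Mδ →
      ∀ lam : ℝ → ℝ, Measurable lam → (∀ t, 0 ≤ lam t ∧ lam t ≤ L) →
        (∀ s T : ℝ, T' ≤ T → (∫ t in s..(s + T), lam t) < T * (1 - ε')) →
        ∀ y : ℝ,
          (∫ t in Set.Ioi (0:ℝ), t ^ b *
            (∑' n : ℕ, convPow p n t *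
              (Real.exp (-(∫ u in (y - t)..y, lam u)) *
                ∑' k : ℕ, (∫ u in (y - t)..y, lam u) ^ (n + k) /
                  (Nat.factorial (n + k) : ℝ)))) ≤ C := by
  by_cases hε1 : ε' < 1
  swap
  · refine ⟨0, fun p _ _ _ _ _ _ _ lam _ hlam havg => ?_⟩
    have h1 := havg 0 T' le_rfl
    have h2 : 0 ≤ ∫ t in (0 : ℝ)..(0 + T'), lam t :=
      intervalIntegral.integral_nonneg (by linarith) fun u _ => (hlam u).1
    nlinarith
  obtain ⟨K₁, K₂, hK₁, hK₂, hK⟩ := exists_rpow_mul_poisson_tail_le (b := b) (d := δ) (c₀ := L * T')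
    hε' hε1 hb0 hδ.le (by linarith)
  set A := momentConst δ (posPartConst δ * (|Mδ| + 2)) with hA
  have hA0 : 0 ≤ A := by
    have := posPartConst_nonneg hδ.le
    rw [hA, momentConst]; positivity
  have hsum : Summable fun n : ℕ => (K₁ + K₂ * A) * ((n : ℝ) + 1) ^ (b - (1 + δ / 2)) := by
    have h := (summable_nat_add_iff 1).2
      (Real.summable_nat_rpow.2 (by linarith : b - (1 + δ / 2) < -1))
    simp only [Nat.cast_add, Nat.cast_one] at h
    exact h.mul_left _
  have hterm0 : ∀ n : ℕ, 0 ≤ (K₁ + K₂ * A) * ((n : ℝ) + 1) ^ (b - (1 + δ / 2)) :=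
    fun n => by positivity
  refine ⟨∑' n : ℕ, (K₁ + K₂ * A) * ((n : ℝ) + 1) ^ (b - (1 + δ / 2)), ?_⟩
  intro p hpm hp hp0 h1 hmean hint hM lam _ hlam havg y
  have hmoment := lintegral_posPart_convPow_le hδ.le (abs_nonneg Mδ) hpm hp hp0 h1 hmean hint
    (hM.trans (le_abs_self _))
  have hmass := lintegral_convPow_le_one hpm hp (lintegral_ofReal_eq_one hp hp0 h1)
  have hcm : ∀ n, Measurable fun t => ENNReal.ofReal (convPow p n t) :=
    fun n => (measurable_convPow hpm n).ennreal_ofReal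
  have hVm : ∀ n : ℕ, Measurable fun t : ℝ =>
      ENNReal.ofReal ((max (t - (n + 1)) 0) ^ (2 + δ)) * ENNReal.ofReal (convPow p n t) :=
    fun n => Measurable.mul (by fun_prop) (hcm n)
  set G : ℕ → ℝ → ENNReal := fun n t =>
    ENNReal.ofReal (K₁ * ((n : ℝ) + 1) ^ (b - (1 + δ / 2))) * ENNReal.ofReal (convPow p n t) +
      ENNReal.ofReal (K₂ * ((n : ℝ) + 1) ^ (b - (2 + δ))) *
        (ENNReal.ofReal ((max (t - (n + 1)) 0) ^ (2 + δ)) * ENNReal.ofReal (convPow p n t)) with hG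
  have hGm : ∀ n, Measurable (G n) :=
    fun n => ((hcm n).const_mul _).add ((hVm n).const_mul _)
  have hGint : ∀ n, ∫⁻ t, G n t ≤
      ENNReal.ofReal ((K₁ + K₂ * A) * ((n : ℝ) + 1) ^ (b - (1 + δ / 2))) := by
    intro n
    have hNpos : (0 : ℝ) < (n : ℝ) + 1 := by positivity
    calc ∫⁻ t, G n t
        = ENNReal.ofReal (K₁ * ((n : ℝ) + 1) ^ (b - (1 + δ / 2))) *
            (∫⁻ t, ENNReal.ofReal (convPow p n t)) +
          ENNReal.ofReal (K₂ * ((n : ℝ) + 1) ^ (b - (2 + δ))) *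
            ∫⁻ t : ℝ, ENNReal.ofReal ((max (t - (n + 1)) 0) ^ (2 + δ)) *
              ENNReal.ofReal (convPow p n t) := by
          rw [hG, lintegral_add_left ((hcm n).const_mul _), lintegral_const_mul _ (hcm n),
            lintegral_const_mul _ (hVm n)]
      _ ≤ ENNReal.ofReal (K₁ * ((n : ℝ) + 1) ^ (b - (1 + δ / 2))) * 1 +
          ENNReal.ofReal (K₂ * ((n : ℝ) + 1) ^ (b - (2 + δ))) *
            ENNReal.ofReal (A * ((n : ℝ) + 1) ^ (1 + δ / 2)) :=
          add_le_add (mul_le_mul_right (hmass n) _) (mul_le_mul_right (hmoment n) _)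
      _ = _ := by
          rw [mul_one, ← ENNReal.ofReal_mul (by positivity),
            ← ENNReal.ofReal_add (by positivity) (by positivity)]
          congr 1
          rw [show b - (1 + δ / 2) = (b - (2 + δ)) + (1 + δ / 2) by ring,
            Real.rpow_add hNpos]
          ring
  rw [← ENNReal.ofReal_le_ofReal_iff (tsum_nonneg hterm0), ENNReal.ofReal_tsum_of_nonneg hterm0 hsum]
  refine (Real.ofReal_le_enorm _).trans ((enorm_integral_le_lintegral_enorm _).trans ?_)
  calc _ ≤ ∫⁻ t in Set.Ioi (0 : ℝ), ∑' n, G n t := by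
        refine setLIntegral_mono' measurableSet_Ioi fun t ht => ?_
        have ht0 : 0 < t := ht
        have hint0 : 0 ≤ ∫ u in (y - t)..y, lam u :=
          intervalIntegral.integral_nonneg (by linarith) fun u _ => (hlam u).1
        have hΛ := intervalIntegral_le_of_average_lt hL.le hT'.le hε1 hlam havg y ht0
        rw [enorm_mul]
        refine (mul_le_mul_right enorm_tsum_le_tsum_enorm _).trans ?_
        rw [← ENNReal.tsum_mul_left]
        refine ENNReal.tsum_le_tsum fun n => ?_
        have hc := convPow_nonneg hp n t
        have hw := hK n t _ ht0 hint0 hΛ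
        rw [← enorm_mul, mul_left_comm, mul_comm, enorm_mul, Real.enorm_of_nonneg hc,
          Real.enorm_of_nonneg (mul_nonneg (by positivity) (mul_nonneg (Real.exp_pos _).le
            (tsum_nonneg fun k => by positivity)))]
        simp only [hG]
        rw [← mul_assoc (ENNReal.ofReal (K₂ * _)), ← add_mul,
          ← ENNReal.ofReal_mul (p := K₂ * _) (by positivity),
          ← ENNReal.ofReal_add (by positivity) (by positivity)]
        exact mul_le_mul_left (ENNReal.ofReal_le_ofReal hw) _
    _ ≤ ∫⁻ t, ∑' n, G n t := setLIntegral_le_lintegral _ _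
    _ = ∑' n, ∫⁻ t, G n t := lintegral_tsum fun n => (hGm n).aemeasurable
    _ ≤ _ := ENNReal.tsum_le_tsum hGint
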